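/- arXiv:2509.22610 — 2 statements merged into one kernel-verified Lean document; each statement's English description precedes it below -/
import Mathlib

section
/- For all integers m, n and every integer i ≥ 1, the identity γ_{m,n+1}^i = γ_{m+1,n}^i + α_{m,n}·γ_{m,n}^{i−1} holds in ℚ(v), where γ_{m,n}^i = {m}_i·{n}_i·binom[m+n+1, i] and α_{m,n} = {m−n}·{m+n+2}. -/
/-!
STATEMENT 1: For all integers m, n and every integer i ≥ 1, the identity
γ_{m,n+1}^i = γ_{m+1,n}^i + α_{m,n}·γ_{m,n}^{i−1} holds in ℚ(v), where
γ_{m,n}^i = {m}_i·{n}_i·binom[m+n+1, i] and α_{m,n} = {m−n}·{m+n+2}.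
-/

noncomputable section

/-- The variable `v` of the field `ℚ(v)`. -/
def V : RatFunc ℚ := RatFunc.X

/-- `{n} = vⁿ − v⁻ⁿ`. -/
def sm (n : ℤ) : RatFunc ℚ := V ^ n - V ^ (-n)

/-- `{n}_k = {n}{n−1}⋯{n−k+1}`. -/
def smP (n : ℤ) (k : ℕ) : RatFunc ℚ := ∏ i ∈ Finset.range k, sm (n - i)

/-- The balanced Gaussian binomial `binom[n,k] = {n}_k/{k}_k`. -/
def bbinom (n : ℤ) (k : ℕ) : RatFunc ℚ := smP n k / smP k k

/-- `γ_{m,n}^i = {m}_i·{n}_i·binom[m+n+1, i]`. -/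
def γ (m n : ℤ) (i : ℕ) : RatFunc ℚ := smP m i * smP n i * bbinom (m + n + 1) i

/-- `α_{m,n} = {m−n}·{m+n+2}`. -/
def α (m n : ℤ) : RatFunc ℚ := sm (m - n) * sm (m + n + 2)

lemma V_ne : V ≠ 0 := RatFunc.X_ne_zero

lemma sm_ne (k : ℕ) : sm ((k : ℤ) + 1) ≠ 0 := by
  intro h
  unfold sm at h
  have h1 : V ^ ((k : ℤ) + 1) = V ^ (-((k : ℤ) + 1)) := sub_eq_zero.mp h
  have h2 : V ^ (2 * k + 2) = 1 := by
    have : V ^ ((k : ℤ) + 1) * V ^ ((k : ℤ) + 1) = 1 := by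
      nth_rewrite 1 [h1]
      rw [← zpow_add₀ V_ne]; simp
    rw [← zpow_add₀ V_ne] at this
    rw [← this, ← zpow_natCast]
    congr 1; push_cast; ring
  unfold V at h2
  rw [← RatFunc.algebraMap_X, ← map_pow, ← map_one (algebraMap (Polynomial ℚ) (RatFunc ℚ))] at h2
  have h3 := RatFunc.algebraMap_injective ℚ h2
  have h4 := congrArg Polynomial.natDegree h3
  simp at h4

lemma smP_succ (n : ℤ) (k : ℕ) : smP n (k + 1) = smP n k * sm (n - k) := by
  simp [smP, Finset.prod_range_succ]

lemma smP_succ_left (n : ℤ) (k : ℕ) : smP (n + 1) (k + 1) = sm (n + 1) * smP n k := by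
  unfold smP
  rw [Finset.prod_range_succ', mul_comm]
  congr 1
  · simp
  · refine Finset.prod_congr rfl fun i _ => ?_
    congr 1; push_cast; ring

lemma smP_ne (k : ℕ) : smP k k ≠ 0 := by
  induction k with
  | zero => simp [smP]
  | succ k ih =>
    push_cast
    rw [smP_succ_left]
    exact mul_ne_zero (sm_ne k) ih

lemma sm_id (m n k : ℤ) :
    sm (m - k) * sm (n + 1) = sm (m + 1) * sm (n - k) + sm (m - n) * sm (k + 1) := by
  have := V_ne
  simp only [sm, neg_sub, neg_add, zpow_sub₀ this, zpow_add₀ this, zpow_neg, zpow_one]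
  have hm : V ^ m ≠ 0 := zpow_ne_zero _ this
  have hn : V ^ n ≠ 0 := zpow_ne_zero _ this
  have hk : V ^ k ≠ 0 := zpow_ne_zero _ this
  generalize V ^ m = a at *
  generalize V ^ n = b at *
  generalize V ^ k = c at *
  field_simp
  ring

theorem gamma_recurrence (m n : ℤ) (i : ℕ) (hi : 1 ≤ i) :
    γ m (n + 1) i = γ (m + 1) n i + α m n * γ m n (i - 1) := by
  obtain ⟨k, rfl⟩ : ∃ k, i = k + 1 := ⟨i - 1, by omega⟩
  have e1 : m + (n + 1) + 1 = (m + n + 1) + 1 := by ring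
  have e2 : (m + 1) + n + 1 = (m + n + 1) + 1 := by ring
  have e3 : m + n + 2 = (m + n + 1) + 1 := by ring
  simp only [γ, α, bbinom, Nat.add_sub_cancel]
  rw [e1, e2, e3]
  push_cast
  simp only [smP_succ_left]
  rw [smP_succ m, smP_succ n]
  have h1 := sm_ne k
  have h2 := smP_ne k
  have h := sm_id m n k
  field_simp
  linear_combination (smP m k * smP n k * sm (m + n + 1 + 1) * smP (m + n + 1) k) * h
end
end

section
/- For every integer k ≥ 0, the partial fraction identity σ̃_{−k−1} = (1 − x⁻¹)·Σ_{j=−k}^{k} R_{k,j}·(x+x⁻¹−q^j−q^{−j})⁻¹ holds in the field ℚ(q)(x), where R_{k,j} = −(−1)^{k+j}·q^{j(j+1)/2 + k(k+1)/2}·((q)_{k−j}·(q)_{k+j})⁻¹. -/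
noncomputable section

/-- The field `ℚ(q)`. -/
abbrev Fq : Type := RatFunc ℚ

/-- The variable `q` of `ℚ(q)`. -/
def qv : Fq := RatFunc.X

/-- `(q)_m = ∏_{i=1}^{m}(1−qⁱ)` in `ℚ(q)`. -/
def qP (m : ℕ) : Fq := ∏ i ∈ Finset.range m, (1 - qv ^ (i + 1))

/-- The field `ℚ(q)(x)` of rational functions in `x` over `ℚ(q)`. -/
abbrev FX : Type := RatFunc Fq

/-- The variable `x` of `ℚ(q)(x)`. -/
def xV : FX := RatFunc.X

/-- `σ̃_{−k−1} = (x⁻¹−1)·∏_{i=0}^{k}(x+x⁻¹−qⁱ−q⁻ⁱ)⁻¹` in `ℚ(q)(x)`. -/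
def σtR (k : ℕ) : FX :=
  (xV⁻¹ - 1) * (∏ i ∈ Finset.range (k + 1),
    (xV + xV⁻¹ - RatFunc.C (qv ^ (i : ℤ)) - RatFunc.C (qv ^ (-(i : ℤ)))))⁻¹

/-- `R_{k,j} = −(−1)^{k+j}·q^{j(j+1)/2 + k(k+1)/2}·((q)_{k−j}·(q)_{k+j})⁻¹`. -/
def Rres (k : ℕ) (j : ℤ) : Fq :=
  -((-1 : Fq) ^ ((k : ℤ) + j) * qv ^ (j * (j + 1) / 2 + (k : ℤ) * ((k : ℤ) + 1) / 2) *
    (qP ((k : ℤ) - j).toNat * qP ((k : ℤ) + j).toNat)⁻¹)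

/-!
STATEMENT 10: For every integer k ≥ 0, the partial fraction identity
σ̃_{−k−1} = (1 − x⁻¹)·Σ_{j=−k}^{k} R_{k,j}·(x+x⁻¹−q^j−q^{−j})⁻¹
holds in the field ℚ(q)(x), where
R_{k,j} = −(−1)^{k+j}·q^{j(j+1)/2 + k(k+1)/2}·((q)_{k−j}·(q)_{k+j})⁻¹.
-/

lemma qv_ne : qv ≠ 0 := RatFunc.X_ne_zero

lemma qv_pow_ne (n : ℕ) (hn : n ≠ 0) : (1 - qv ^ n : Fq) ≠ 0 := by
  intro h
  have h1 : (qv ^ n : Fq) = 1 := (sub_eq_zero.mp h).symm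
  have h2 : (algebraMap (Polynomial ℚ) Fq) (Polynomial.X ^ n) = algebraMap (Polynomial ℚ) Fq 1 := by
    rw [map_pow, map_one, RatFunc.algebraMap_X]; exact h1
  have h3 := RatFunc.algebraMap_injective ℚ h2
  have h4 := congrArg Polynomial.natDegree h3
  simp at h4
  exact hn h4

lemma qP_ne (m : ℕ) : qP m ≠ 0 := by
  unfold qP
  exact Finset.prod_ne_zero_iff.mpr fun i _ => qv_pow_ne (i + 1) (by omega)

lemma qP_succ (m : ℕ) : qP (m + 1) = qP m * (1 - qv ^ (m + 1)) := by
  unfold qP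
  rw [Finset.prod_range_succ]

lemma tri_succ (j : ℤ) : (j + 1) * (j + 1 + 1) / 2 = j * (j + 1) / 2 + (j + 1) := by
  have : (j + 1) * (j + 1 + 1) = j * (j + 1) + 2 * (j + 1) := by ring
  rw [this, Int.add_mul_ediv_left _ _ (by norm_num)]

lemma tri_neg (j : ℤ) : (-j) * (-j + 1) / 2 = j * (j + 1) / 2 + (-j) := by
  have : (-j) * (-j + 1) = j * (j + 1) + 2 * (-j) := by ring
  rw [this, Int.add_mul_ediv_left _ _ (by norm_num)]

lemma neg_one_zpow_neg (k j : ℤ) : (-1 : Fq) ^ (k + -j) = (-1 : Fq) ^ (k + j) := by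
  have h : (-1 : Fq) ≠ 0 := by simp
  rw [zpow_add₀ h, zpow_add₀ h, zpow_neg, ← inv_zpow]
  norm_num

lemma Rres_neg (k : ℕ) (j : ℤ) : Rres k (-j) = Rres k j * qv ^ (-j) := by
  unfold Rres
  rw [neg_one_zpow_neg, tri_neg, sub_neg_eq_add, ← sub_eq_add_neg (k : ℤ) j,
    show j * (j + 1) / 2 + (-j) + (k : ℤ) * ((k : ℤ) + 1) / 2
      = (j * (j + 1) / 2 + (k : ℤ) * ((k : ℤ) + 1) / 2) + (-j) by ring,
    zpow_add₀ qv_ne, mul_comm (qP _) (qP _)]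
  ring

lemma Rres_step (J n : ℕ) :
    Rres (J + 1 + n) ((J : ℤ) + 1) * (1 - qv ^ (J + 1 + n + J + 1))
      = -Rres (J + 1 + n) J * qv ^ (J + 1) * (1 - qv ^ (n + 1)) := by
  unfold Rres
  have e1 : (((J + 1 + n : ℕ) : ℤ) - ((J : ℤ) + 1)).toNat = n := by omega
  have e2 : (((J + 1 + n : ℕ) : ℤ) + ((J : ℤ) + 1)).toNat = J + 1 + n + J + 1 := by omega
  have e3 : (((J + 1 + n : ℕ) : ℤ) - (J : ℤ)).toNat = n + 1 := by omega
  have e4 : (((J + 1 + n : ℕ) : ℤ) + (J : ℤ)).toNat = J + 1 + n + J := by omega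
  have hm : (-1 : Fq) ≠ 0 := by simp
  rw [e1, e2, e3, e4, tri_succ, qP_succ n, qP_succ (J + 1 + n + J), ← add_assoc,
    zpow_add₀ hm _ 1, add_right_comm ((J : ℤ) * ((J : ℤ) + 1) / 2), zpow_add₀ qv_ne _ ((J : ℤ) + 1)]
  have h5 : qv ^ ((J : ℤ) + 1) = qv ^ (J + 1) := by norm_cast
  rw [h5]
  have a1 := qP_ne n
  have a2 := qP_ne (J + 1 + n + J)
  have a3 := qv_pow_ne (n + 1) (by omega)
  have a4 := qv_pow_ne (J + 1 + n + J + 1) (by omega)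
  generalize qv ^ ((J : ℤ) * ((J : ℤ) + 1) / 2 +
    ((J + 1 + n : ℕ) : ℤ) * (((J + 1 + n : ℕ) : ℤ) + 1) / 2) = A
  generalize (-1 : Fq) ^ (((J + 1 + n : ℕ) : ℤ) + (J : ℤ)) = B
  generalize 1 - qv ^ (n + 1) = u at *
  generalize 1 - qv ^ (J + 1 + n + J + 1) = v at *
  field_simp

lemma sum_Icc_succ {M : Type*} [AddCommMonoid M] (f : ℤ → M) (J : ℕ) :
    ∑ j ∈ Finset.Icc (-((J + 1 : ℕ) : ℤ)) ((J + 1 : ℕ) : ℤ), f j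
      = (∑ j ∈ Finset.Icc (-(J : ℤ)) (J : ℤ), f j) + (f ((J : ℤ) + 1) + f (-((J : ℤ) + 1))) := by
  have h : Finset.Icc (-((J + 1 : ℕ) : ℤ)) ((J + 1 : ℕ) : ℤ)
      = insert (-((J : ℤ) + 1)) (insert ((J : ℤ) + 1) (Finset.Icc (-(J : ℤ)) (J : ℤ))) := by
    ext a
    simp only [Finset.mem_Icc, Finset.mem_insert]
    push_cast
    omega
  rw [h, Finset.sum_insert, Finset.sum_insert]
  · rw [add_comm (f (-((J : ℤ) + 1))), add_comm (f ((J : ℤ) + 1)), add_assoc]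
  · simp
  · simp only [Finset.mem_Icc, Finset.mem_insert]
    omega

lemma sum_partial (k : ℕ) (hk : k ≠ 0) (J : ℕ) (hJ : J ≤ k) :
    (∑ j ∈ Finset.Icc (-(J : ℤ)) (J : ℤ), Rres k j) * (1 - qv ^ k)
      = Rres k J * (1 - qv ^ (k - J)) := by
  induction J with
  | zero => simp
  | succ J ih =>
    have ih := ih (by omega)
    obtain ⟨n, rfl⟩ := Nat.exists_eq_add_of_le hJ
    rw [sum_Icc_succ, add_mul, ih, Rres_neg, zpow_neg]
    have hs := Rres_step J n
    have e1 : J + 1 + n - J = n + 1 := by omega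
    have e2 : J + 1 + n - (J + 1) = n := by omega
    have h5 : qv ^ ((J : ℤ) + 1) = qv ^ (J + 1) := by norm_cast
    rw [e1, e2, h5]
    push_cast
    have hq : qv ^ (J + 1) ≠ 0 := pow_ne_zero _ qv_ne
    rw [show J + 1 + n + J + 1 = (J + 1) + (J + 1) + n by ring, pow_add, pow_add] at hs
    rw [pow_add qv (J + 1) n]
    apply mul_right_cancel₀ hq
    generalize Rres (J + 1 + n) ((J : ℤ) + 1) = A at *
    generalize Rres (J + 1 + n) (J : ℤ) = B at *
    generalize 1 - qv ^ (n + 1) = D at *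
    generalize qv ^ (J + 1) = Q at *
    generalize qv ^ n = N at *
    field_simp
    linear_combination hs

lemma sum_zero (k : ℕ) (hk : k ≠ 0) :
    ∑ j ∈ Finset.Icc (-(k : ℤ)) (k : ℤ), Rres k j = 0 := by
  have h := sum_partial k hk k le_rfl
  simp only [Nat.sub_self, pow_zero, sub_self, mul_zero] at h
  exact (mul_eq_zero.mp h).resolve_right (qv_pow_ne k hk)

lemma Rres_rec (k : ℕ) (j : ℤ) (h1 : -(k : ℤ) ≤ j) (h2 : j ≤ k) :
    Rres (k + 1) j * (qv ^ j + qv ^ (-j) - qv ^ ((k + 1 : ℕ) : ℤ) - qv ^ (-((k + 1 : ℕ) : ℤ)))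
      = Rres k j := by
  obtain ⟨a, ha⟩ := Int.eq_ofNat_of_zero_le (show 0 ≤ (k : ℤ) - j by omega)
  obtain ⟨b, hb⟩ := Int.eq_ofNat_of_zero_le (show 0 ≤ (k : ℤ) + j by omega)
  unfold Rres
  have e1 : (((k + 1 : ℕ) : ℤ) - j).toNat = a + 1 := by omega
  have e2 : (((k + 1 : ℕ) : ℤ) + j).toNat = b + 1 := by omega
  have e3 : ((k : ℤ) - j).toNat = a := by omega
  have e4 : ((k : ℤ) + j).toNat = b := by omega
  have hm : (-1 : Fq) ≠ 0 := by simp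
  rw [e1, e2, e3, e4, qP_succ, qP_succ, Nat.cast_succ, tri_succ, add_right_comm,
    zpow_add₀ hm _ 1, ← add_assoc, zpow_add₀ qv_ne _ ((k : ℤ) + 1)]
  have a1 := qP_ne a
  have a2 := qP_ne b
  have a3 := qv_pow_ne (a + 1) (by omega)
  have a4 := qv_pow_ne (b + 1) (by omega)
  have key : qv ^ ((k : ℤ) + 1) * (qv ^ j + qv ^ (-j) - qv ^ ((k : ℤ) + 1) - qv ^ (-((k : ℤ) + 1)))
      = -((1 - qv ^ (a + 1)) * (1 - qv ^ (b + 1))) := by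
    have f1 : qv ^ (a + 1) = qv ^ ((k : ℤ) + 1) * qv ^ (-j) := by
      rw [← zpow_add₀ qv_ne, ← zpow_natCast]; congr 1; push_cast; omega
    have f2 : qv ^ (b + 1) = qv ^ ((k : ℤ) + 1) * qv ^ j := by
      rw [← zpow_add₀ qv_ne, ← zpow_natCast]; congr 1; push_cast; omega
    rw [f1, f2, zpow_neg, zpow_neg]
    have g1 : qv ^ j ≠ 0 := zpow_ne_zero _ qv_ne
    have g2 : qv ^ ((k : ℤ) + 1) ≠ 0 := zpow_ne_zero _ qv_ne
    generalize qv ^ j = A at *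
    generalize qv ^ ((k : ℤ) + 1) = B at *
    field_simp
    ring
  generalize qv ^ (j * (j + 1) / 2 + (k : ℤ) * ((k : ℤ) + 1) / 2) = A
  generalize (-1 : Fq) ^ ((k : ℤ) + j) = B
  generalize (qv ^ j + qv ^ (-j) - qv ^ ((k : ℤ) + 1) - qv ^ (-((k : ℤ) + 1))) = C at *
  generalize qv ^ ((k : ℤ) + 1) = E at *
  generalize 1 - qv ^ (a + 1) = u at *
  generalize 1 - qv ^ (b + 1) = v at *
  field_simp
  linear_combination A * B * key

lemma den_ne (j : ℤ) : xV + xV⁻¹ - RatFunc.C (qv ^ j) - RatFunc.C (qv ^ (-j)) ≠ 0 := by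
  intro h
  have hx : xV ≠ 0 := RatFunc.X_ne_zero
  have h1 : xV ^ 2 - RatFunc.C (qv ^ j + qv ^ (-j)) * xV + 1 = 0 := by
    have := congrArg (· * xV) h
    simp only [zero_mul] at this
    rw [map_add, ← this]
    field_simp
    ring
  have h2 : algebraMap (Polynomial Fq) FX
      (Polynomial.X ^ 2 - Polynomial.C (qv ^ j + qv ^ (-j)) * Polynomial.X + 1) = 0 := by
    rw [← h1]
    simp only [map_add, map_sub, map_mul, map_pow, map_one, RatFunc.algebraMap_X,
      RatFunc.algebraMap_C]
    rfl
  rw [map_eq_zero_iff _ (RatFunc.algebraMap_injective Fq)] at h2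
  have h3 := congrArg (fun p => Polynomial.eval 0 p) h2
  simp at h3

lemma main_sum (k : ℕ) :
    ∑ j ∈ Finset.Icc (-(k : ℤ)) (k : ℤ), RatFunc.C (Rres k j) *
        (xV + xV⁻¹ - RatFunc.C (qv ^ j) - RatFunc.C (qv ^ (-j)))⁻¹
      = -(∏ i ∈ Finset.range (k + 1),
    (xV + xV⁻¹ - RatFunc.C (qv ^ (i : ℤ)) - RatFunc.C (qv ^ (-(i : ℤ)))))⁻¹ := by
  induction k with
  | zero => simp [Rres, qP]
  | succ k ih =>
    rw [Finset.prod_range_succ, mul_inv, ← neg_mul, ← ih, eq_mul_inv_iff_mul_eq₀ (den_ne _),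
      Finset.sum_mul]
    have hterm : ∀ j : ℤ, RatFunc.C (Rres (k + 1) j) *
        (xV + xV⁻¹ - RatFunc.C (qv ^ j) - RatFunc.C (qv ^ (-j)))⁻¹ *
        (xV + xV⁻¹ - RatFunc.C (qv ^ ((k + 1 : ℕ) : ℤ)) - RatFunc.C (qv ^ (-((k + 1 : ℕ) : ℤ))))
        = RatFunc.C (Rres (k + 1) j) + RatFunc.C (Rres (k + 1) j *
          (qv ^ j + qv ^ (-j) - qv ^ ((k + 1 : ℕ) : ℤ) - qv ^ (-((k + 1 : ℕ) : ℤ)))) *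
          (xV + xV⁻¹ - RatFunc.C (qv ^ j) - RatFunc.C (qv ^ (-j)))⁻¹ := by
      intro j
      have hd := den_ne j
      simp only [map_mul, map_sub, map_add]
      generalize RatFunc.C (qv ^ j) = A at *
      generalize RatFunc.C (qv ^ (-j)) = B at *
      generalize RatFunc.C (qv ^ ((k + 1 : ℕ) : ℤ)) = A' at *
      generalize RatFunc.C (qv ^ (-((k + 1 : ℕ) : ℤ))) = B' at *
      generalize RatFunc.C (Rres (k + 1) j) = R at *
      generalize xV + xV⁻¹ = y at *
      field_simp
      ring
    rw [Finset.sum_congr rfl fun j _ => hterm j, Finset.sum_add_distrib, ← map_sum,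
      sum_zero (k + 1) (by omega), map_zero, zero_add, sum_Icc_succ]
    have z1 : (qv ^ ((k : ℤ) + 1) + qv ^ (-((k : ℤ) + 1)) - qv ^ ((k + 1 : ℕ) : ℤ)
        - qv ^ (-((k + 1 : ℕ) : ℤ))) = 0 := by push_cast; ring
    have z2 : (qv ^ (-((k : ℤ) + 1)) + qv ^ (-(-((k : ℤ) + 1))) - qv ^ ((k + 1 : ℕ) : ℤ)
        - qv ^ (-((k + 1 : ℕ) : ℤ))) = 0 := by rw [neg_neg]; push_cast; ring
    rw [z1, z2]
    simp only [mul_zero, map_zero, zero_mul, add_zero]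
    refine Finset.sum_congr rfl fun j hj => ?_
    rw [Finset.mem_Icc] at hj
    rw [Rres_rec k j hj.1 hj.2]

theorem partial_fraction_expansion (k : ℕ) :
    σtR k = (1 - xV⁻¹) * ∑ j ∈ Finset.Icc (-(k : ℤ)) (k : ℤ),
      RatFunc.C (Rres k j) *
        (xV + xV⁻¹ - RatFunc.C (qv ^ j) - RatFunc.C (qv ^ (-j)))⁻¹ := by
  rw [main_sum, σtR]
  ring
end
end
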